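/- arXiv:2502.20278 — 2 statements merged into one kernel-verified Lean document; each statement's English description precedes it below -/
import Mathlib

section
/- Let Z be a random variable taking values in {1,...,k} with entropy H(Z) ≥ log₂(k) − β. Then for every a ∈ {1,...,k}, P[Z = a] ≥ H⁻¹(h), where h = log₂(k/(k−1)) − β and H⁻¹ is the inverse of the binary entropy function restricted to [0, 1/2]. -/
/-- `-(x log₂ x)`, with the convention `0 log 0 = 0` (since `Real.logb 2 0 = 0`). -/
noncomputable def negMulLogb (x : ℝ) : ℝ := -(x * Real.logb 2 x)

/-- The binary entropy function (base 2). -/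
noncomputable def binH (p : ℝ) : ℝ := negMulLogb p + negMulLogb (1 - p)

/-- The base-2 Shannon entropy of a distribution `p` on `Fin k`. -/
noncomputable def entropy {k : ℕ} (p : Fin k → ℝ) : ℝ := ∑ i, negMulLogb (p i)

open Real in
/-- Among nonnegative weights on a finite set with prescribed total, `∑ negMulLog` is largest at
the constant ones. -/
theorem sum_negMulLog_le {ι : Type*} (s : Finset ι) (hs : s.Nonempty) (p : ι → ℝ)
    (hp : ∀ i ∈ s, 0 ≤ p i) :
    ∑ i ∈ s, negMulLog (p i) ≤
      negMulLog (∑ i ∈ s, p i) + (∑ i ∈ s, p i) * log s.card := by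
  have hn : (0 : ℝ) < s.card := by exact_mod_cast hs.card_pos
  have jensen := concaveOn_negMulLog.le_map_sum (t := s) (w := fun _ => (s.card : ℝ)⁻¹) (p := p)
    (fun _ _ => by positivity) (by simp [hn.ne']) hp
  simp only [smul_eq_mul, ← Finset.mul_sum] at jensen
  rw [inv_mul_le_iff₀ hn, negMulLog_mul] at jensen
  refine jensen.trans_eq ?_
  simp only [negMulLog, log_inv]
  field_simp
  ring

theorem negMulLogb_eq (x : ℝ) : negMulLogb x = Real.negMulLog x / Real.log 2 := by
  simp only [negMulLogb, Real.negMulLog, Real.logb]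
  ring

theorem binH_eq (x : ℝ) : binH x = Real.binEntropy x / Real.log 2 := by
  rw [binH, negMulLogb_eq, negMulLogb_eq, Real.binEntropy_eq_negMulLog_add_negMulLog_one_sub,
    add_div]

/-- Conditioning on the indicator of the outcome `a` bounds the entropy of a distribution. -/
theorem entropy_le_binH_add_logb {k : ℕ} (hk : 2 ≤ k) (p : Fin k → ℝ)
    (hp0 : ∀ i, 0 ≤ p i) (hp1 : ∑ i, p i = 1) (a : Fin k) :
    entropy p ≤ binH (p a) + Real.logb 2 ((k : ℝ) - 1) := by
  have hlog2 : 0 < Real.log 2 := Real.log_pos one_lt_two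
  have hk' : (2 : ℝ) ≤ k := by exact_mod_cast hk
  have hcard : (Finset.univ.erase a).card = k - 1 := by simp
  have hcast : ((k - 1 : ℕ) : ℝ) = (k : ℝ) - 1 := by
    rw [Nat.cast_sub (by lia), Nat.cast_one]
  have hsum : ∑ i ∈ Finset.univ.erase a, p i = 1 - p a := by
    rw [← hp1, ← Finset.add_sum_erase _ p (Finset.mem_univ a)]
    ring
  have hrest := sum_negMulLog_le (Finset.univ.erase a)
    (Finset.card_pos.mp (by lia)) p fun i _ => hp0 i
  rw [hsum, hcard, hcast] at hrest
  have hlog : 0 ≤ Real.log ((k : ℝ) - 1) := Real.log_nonneg (by linarith)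
  simp only [entropy, negMulLogb_eq, binH_eq, ← Finset.sum_div, Real.logb]
  rw [← add_div, div_le_div_iff_of_pos_right hlog2, ← Finset.add_sum_erase _ _ (Finset.mem_univ a),
    Real.binEntropy_eq_negMulLog_add_negMulLog_one_sub]
  nlinarith [mul_nonneg (hp0 a) hlog]

theorem binH_strictMonoOn : StrictMonoOn binH (Set.Icc 0 2⁻¹) := fun x hx y hy hxy => by
  rw [binH_eq, binH_eq]
  exact div_lt_div_of_pos_right (Real.binEntropy_strictMonoOn hx hy hxy) (Real.log_pos one_lt_two)

/-- If a random variable `Z` on `{1,…,k}` (with distribution `p`) has entropy at least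
`log₂ k − β`, then every outcome has probability at least `H⁻¹(h)` where
`h = log₂(k/(k−1)) − β`; the inverse binary entropy value is expressed as any
`q ∈ [0, 1/2]` with `binH q = h`. -/
theorem stmt_10 (k : ℕ) (hk : 2 ≤ k) (p : Fin k → ℝ)
    (hp0 : ∀ i, 0 ≤ p i) (hp1 : ∑ i, p i = 1) (β : ℝ)
    (hH : Real.logb 2 k - β ≤ entropy p)
    (q : ℝ) (hq0 : 0 ≤ q) (hqhalf : q ≤ 1 / 2)
    (hqh : binH q = Real.logb 2 ((k : ℝ) / ((k : ℝ) - 1)) - β) :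
    ∀ a : Fin k, q ≤ p a := by
  intro a
  by_contra! hlt
  have hk' : (2 : ℝ) ≤ k := by exact_mod_cast hk
  have hmono : binH (p a) < binH q :=
    binH_strictMonoOn ⟨hp0 a, by linarith⟩ ⟨hq0, by linarith⟩ hlt
  have hle := entropy_le_binH_add_logb hk p hp0 hp1 a
  rw [Real.logb_div (by linarith) (by linarith)] at hqh
  linarith
end

section
/- Let F and H be graphs with a homomorphism H → F and H not bipartite, and let g be the length of a shortest odd cycle in H. Then for all sufficiently small ε > 0 there exists an H-hom-free graph G such that G has no ε-approximate homomorphism to any F-hom-free graph on at most c·(1/ε)^{1/2 + 1/(2g)} vertices, where c > 0 depends only on F and H. -/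
/-- `Γ` is `F`-hom-free: there is no graph homomorphism from `F` to `Γ`. -/
def HomFree {VF W : Type*} (F : SimpleGraph VF) (Γ : SimpleGraph W) : Prop :=
  IsEmpty (F →g Γ)

/-- `f` is an `ε`-approximate homomorphism from `G` to `Γ`. -/
def IsApproxHom {V W : Type*} [Fintype V] (ε : ℝ) (G : SimpleGraph V)
    (Γ : SimpleGraph W) (f : V → W) : Prop :=
  (Set.ncard {e : Sym2 V | e ∈ G.edgeSet ∧ Sym2.map f e ∉ Γ.edgeSet} : ℝ)
    ≤ ε * (Fintype.card V : ℝ) ^ 2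

open Finset

theorem exists_isCycle_length_le_of_odd_closed_walk {V : Type*} {G : SimpleGraph V} {v : V}
    (w : G.Walk v v) (hw : Odd w.length) :
    ∃ (u : V) (c : G.Walk u u), c.IsCycle ∧ c.length ≤ w.length := by
  classical
  set K : SimpleGraph V := SimpleGraph.fromEdgeSet {e | e ∈ w.edges} with hK
  have hKG : K ≤ G := by
    intro a b hab
    rw [hK, SimpleGraph.fromEdgeSet_adj] at hab
    exact w.adj_of_mem_edges hab.1
  have hmem : ∀ e ∈ w.edges, e ∈ K.edgeSet := fun e he => by
    rw [hK, SimpleGraph.edgeSet_fromEdgeSet]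
    exact ⟨he, G.not_isDiag_of_mem_edgeSet (w.edges_subset_edgeSet he)⟩
  have hnot : ¬ K.IsAcyclic := fun hac => by
    have h := SimpleGraph.two_colorable_iff_forall_loop_even.1 hac.colorable_two v
      (w.transfer K hmem)
    rw [SimpleGraph.Walk.length_transfer] at h
    exact (Nat.not_even_iff_odd.2 hw) h
  simp only [SimpleGraph.IsAcyclic, not_forall, not_not] at hnot
  obtain ⟨u, c, hc⟩ := hnot
  refine ⟨u, c.mapLe hKG, (SimpleGraph.Walk.isCycle_mapLe hKG).2 hc, ?_⟩
  have hsub : c.edges ⊆ w.edges := fun e he => by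
    have := c.edges_subset_edgeSet he
    rw [hK, SimpleGraph.edgeSet_fromEdgeSet] at this
    exact this.1
  have := (hc.isTrail.edges_nodup.subperm hsub).length_le
  simpa using this

/-- The set of edges traversed by the closed sequence of vertices `c`. -/
def closedSeqEdges {V : Type*} [DecidableEq V] {l : ℕ} (c : Fin (l + 1) → V) : Finset (Sym2 V) :=
  univ.image fun i => s(c i, c (i + 1))

theorem exists_closedSeqEdges_of_isCycle {V : Type*} [DecidableEq V] {G : SimpleGraph V} {v : V}
    {w : G.Walk v v} (hw : w.IsCycle) {l : ℕ} (hl : w.length = l + 1) :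
    ∃ c : Fin (l + 1) → V, #(closedSeqEdges c) = l + 1 ∧
      ∀ e ∈ closedSeqEdges c, e ∈ G.edgeSet := by
  have key : ∀ i : Fin (l + 1), w.getVert (i + 1 : Fin (l + 1)) = w.getVert (i + 1 : ℕ) := by
    intro i
    rw [Fin.val_add_one]
    split_ifs with h
    · subst h
      rw [Fin.val_last, ← hl, w.getVert_length, w.getVert_zero]
    · rfl
  refine ⟨fun i => w.getVert i, ?_, ?_⟩
  · rw [closedSeqEdges, card_image_of_injective, card_univ, Fintype.card_fin]
    intro i j hij
    simp only [key] at hij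
    have hi : (i : ℕ) < w.edges.length := by
      rw [w.length_edges, hl]
      exact i.isLt
    have hj : (j : ℕ) < w.edges.length := by
      rw [w.length_edges, hl]
      exact j.isLt
    have h : w.edges[(i : ℕ)] = w.edges[(j : ℕ)] := by
      simpa [SimpleGraph.Walk.edges, SimpleGraph.Walk.darts_getElem_eq_getVert] using hij
    exact Fin.ext ((hw.isTrail.edges_nodup.getElem_inj_iff).1 h)
  · intro e he
    obtain ⟨i, -, rfl⟩ := mem_image.1 he
    simp only [key]
    exact w.adj_getVert_succ (by omega)

theorem exists_mem_lt_of_weighted_sum_lt {ι : Type*} (s : Finset ι) (w Φ : ι → ℝ) (b : ℝ)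
    (hw : ∀ i ∈ s, 0 ≤ w i) (hw1 : ∑ i ∈ s, w i = 1) (h : ∑ i ∈ s, w i * Φ i < b) :
    ∃ i ∈ s, Φ i < b := by
  by_contra! hcon
  have : ∑ i ∈ s, w i * b ≤ ∑ i ∈ s, w i * Φ i :=
    sum_le_sum fun i hi => mul_le_mul_of_nonneg_left (hcon i hi) (hw i hi)
  rw [← sum_mul, hw1] at this
  linarith

section Bernoulli

variable {E : Type*} [DecidableEq E]

/-- Every set can be made to contain no member of `𝒯` by deleting at most one element for each
member it contains. -/
theorem exists_card_le_forall_not_subset_sdiff (𝒯 : Finset (Finset E))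
    (hne : ∀ T ∈ 𝒯, T.Nonempty) (S : Finset E) :
    ∃ D : Finset E, #D ≤ #{T ∈ 𝒯 | T ⊆ S} ∧ ∀ T ∈ 𝒯, ¬ T ⊆ S \ D := by
  rcases 𝒯.eq_empty_or_nonempty with rfl | ⟨T₀, hT₀⟩
  · exact ⟨∅, by simp, by simp⟩
  have : Nonempty E := (hne T₀ hT₀).to_type
  choose! x hx using hne
  refine ⟨image x {T ∈ 𝒯 | T ⊆ S}, card_image_le, fun T hT hsub => ?_⟩
  refine (mem_sdiff.1 (hsub (hx T hT))).2 (mem_image_of_mem x (mem_filter.2 ⟨hT, ?_⟩))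
  exact hsub.trans sdiff_subset

variable [Fintype E]

/-- The probability of the outcome `S` when every element of `E` is selected independently with
probability `p`. -/
def bernoulliWeight (p : ℝ) (S : Finset E) : ℝ :=
  (∏ _e ∈ S, p) * ∏ _e ∈ univ \ S, (1 - p)

theorem bernoulliWeight_nonneg {p : ℝ} (h0 : 0 ≤ p) (h1 : p ≤ 1) (S : Finset E) :
    0 ≤ bernoulliWeight p S :=
  mul_nonneg (prod_nonneg fun _ _ => h0) (prod_nonneg fun _ _ => sub_nonneg.2 h1)

theorem sum_bernoulliWeight_mul_prod (p : ℝ) (a b : E → ℝ) :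
    ∑ S : Finset E, bernoulliWeight p S * ((∏ e ∈ S, a e) * ∏ e ∈ univ \ S, b e) =
      ∏ e, (p * a e + (1 - p) * b e) := by
  rw [prod_add, powerset_univ]
  refine sum_congr rfl fun S _ => ?_
  rw [prod_mul_distrib, prod_mul_distrib, bernoulliWeight]
  ring

theorem sum_bernoulliWeight (p : ℝ) : ∑ S : Finset E, bernoulliWeight p S = 1 := by
  simpa using sum_bernoulliWeight_mul_prod p (fun _ : E => 1) fun _ => 1

theorem sum_bernoulliWeight_subset (p : ℝ) (T : Finset E) :
    ∑ S : Finset E, bernoulliWeight p S * (if T ⊆ S then 1 else 0) = p ^ #T := by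
  have h := sum_bernoulliWeight_mul_prod p (fun _ : E => 1) fun e => if e ∈ T then 0 else 1
  have hr : ∏ e : E, (p * 1 + (1 - p) * (if e ∈ T then (0 : ℝ) else 1)) = p ^ #T := by
    rw [← prod_const, ← prod_subset (subset_univ T)]
    · exact prod_congr rfl fun e he => by simp [he]
    · intro e _ he
      simp [he]
  rw [← hr, ← h]
  refine sum_congr rfl fun S _ => ?_
  congr 1
  split_ifs with hTS
  · rw [prod_const_one, one_mul, prod_eq_one]
    intro e he
    rw [if_neg fun heT => (mem_sdiff.1 he).2 (hTS heT)]
  · obtain ⟨e, heT, heS⟩ := not_subset.1 hTS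
    rw [prod_eq_zero (i := e) (s := univ \ S) (by simpa using heS) (by simp [heT]), mul_zero]

theorem sum_bernoulliWeight_half_pow (p : ℝ) (B : Finset E) :
    ∑ S : Finset E, bernoulliWeight p S * (1 / 2) ^ #(S ∩ B) = (1 - p / 2) ^ #B := by
  have h := sum_bernoulliWeight_mul_prod p (fun e : E => if e ∈ B then 1 / 2 else 1) fun _ => 1
  have hr : ∏ e : E, (p * (if e ∈ B then (1 / 2 : ℝ) else 1) + (1 - p) * 1) =
      (1 - p / 2) ^ #B := by
    rw [← prod_const, ← prod_subset (subset_univ B)]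
    · exact prod_congr rfl fun e he => by simp only [he, if_true]; ring
    · intro e _ he
      simp [he]
  rw [← hr, ← h]
  refine sum_congr rfl fun S _ => ?_
  rw [prod_ite]
  simp [filter_mem_eq_inter]

/-- If the sets of `𝒯` are unlikely to be selected and the sets of `ℬ` are likely to be met more
than `2 * n` times, then some set does the latter while containing fewer than `n` sets of `𝒯`. -/
theorem exists_few_subsets_large_inter {p : ℝ} (h0 : 0 ≤ p) (h1 : p ≤ 1) {n : ℕ} (hn : 0 < n)
    (𝒯 ℬ : Finset (Finset E))
    (h : (∑ T ∈ 𝒯, p ^ #T) / n + ∑ B ∈ ℬ, 4 ^ n * (1 - p / 2) ^ #B < 1) :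
    ∃ S : Finset E, #{T ∈ 𝒯 | T ⊆ S} < n ∧ ∀ B ∈ ℬ, 2 * n < #(S ∩ B) := by
  have hn' : (0 : ℝ) < n := by exact_mod_cast hn
  obtain ⟨S, -, hS⟩ := exists_mem_lt_of_weighted_sum_lt (univ : Finset (Finset E))
    (bernoulliWeight p)
    (fun S => (∑ T ∈ 𝒯, if T ⊆ S then (1 : ℝ) else 0) / n +
      ∑ B ∈ ℬ, 4 ^ n * (1 / 2) ^ #(S ∩ B)) 1
    (fun S _ => bernoulliWeight_nonneg h0 h1 S) (sum_bernoulliWeight p) (by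
      refine lt_of_eq_of_lt ?_ h
      simp_rw [mul_add, sum_add_distrib]
      congr 1
      · simp_rw [← mul_div_assoc, ← sum_div, mul_sum]
        rw [sum_comm]
        simp_rw [sum_bernoulliWeight_subset]
      · simp_rw [mul_sum]
        rw [sum_comm]
        refine sum_congr rfl fun B _ => ?_
        rw [← sum_bernoulliWeight_half_pow, mul_sum]
        exact sum_congr rfl fun S _ => by ring)
  have hnn : ∀ B ∈ ℬ, (0 : ℝ) ≤ 4 ^ n * (1 / 2) ^ #(S ∩ B) := fun B _ => by positivity
  have hcard : (∑ T ∈ 𝒯, if T ⊆ S then (1 : ℝ) else 0) = #{T ∈ 𝒯 | T ⊆ S} := by simp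
  rw [hcard] at hS
  refine ⟨S, ?_, fun B hB => ?_⟩
  · have := sum_nonneg hnn
    have h2 : (#{T ∈ 𝒯 | T ⊆ S} : ℝ) / n < 1 := by linarith
    rw [div_lt_one hn'] at h2
    exact_mod_cast h2
  · have h2 := single_le_sum hnn hB
    have h3 : (0 : ℝ) ≤ (#{T ∈ 𝒯 | T ⊆ S} : ℝ) / n := by positivity
    have h4 : (4 : ℝ) ^ n * (1 / 2) ^ #(S ∩ B) < 1 := by linarith
    rw [one_div, inv_pow, ← div_eq_mul_inv, div_lt_one (by positivity),
      show (4 : ℝ) = 2 ^ 2 by norm_num, ← pow_mul] at h4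
    exact (pow_lt_pow_iff_right₀ (by norm_num)).1 h4

end Bernoulli

theorem card_compl_edgeFinset_of_cliqueFree {n r : ℕ} (hr : 0 < r) (hn : 2 * r ≤ n)
    (G : SimpleGraph (Fin n)) [DecidableRel G.Adj] (hG : G.CliqueFree (r + 1)) :
    n ^ 2 ≤ 4 * r * #(Gᶜ).edgeFinset := by
  classical
  have h1 : #G.edgeFinset ≤ #(SimpleGraph.turanGraph n r).edgeFinset :=
    (SimpleGraph.isTuranMaximal_turanGraph hr).2 hG
  have h2 := SimpleGraph.mul_card_edgeFinset_turanGraph_le (n := n) (r := r)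
  have h3 : #G.edgeFinset + #(Gᶜ).edgeFinset = n.choose 2 := by
    have hu : G.edgeFinset ∪ (Gᶜ).edgeFinset = (⊤ : SimpleGraph (Fin n)).edgeFinset := by
      rw [← coe_inj]
      simp only [coe_union, SimpleGraph.coe_edgeFinset]
      rw [← SimpleGraph.edgeSet_sup, sup_compl_eq_top]
    rw [← card_union_of_disjoint, hu]
    · rw [SimpleGraph.card_edgeFinset_top_eq_card_choose_two, Fintype.card_fin]
    · exact SimpleGraph.disjoint_edgeFinset.2 disjoint_compl_right
  have h4 : n.choose 2 * 2 = n * (n - 1) := by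
    rw [Nat.choose_two_right]
    exact Nat.div_mul_cancel (Nat.even_mul_pred_self n).two_dvd
  obtain ⟨r, rfl⟩ := Nat.exists_eq_add_one.2 hr
  obtain ⟨n, rfl⟩ := Nat.exists_eq_add_one.2 (show 0 < n by omega)
  simp only [Nat.add_sub_cancel] at h2 h4
  nlinarith [Nat.mul_le_mul_left (2 * (r + 1)) h1]

/-- The deletion method: a random graph with its short cycles destroyed is far from every pullback
of a graph on `M` vertices that has no clique of size `r + 1`. -/
theorem exists_girth_gt_far_from_cliqueFree {n M g r : ℕ} {p : ℝ} (h0 : 0 ≤ p) (h1 : p ≤ 1)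
    (hr : 0 < r) (hn : 2 * r ≤ n)
    (h : (∑ l ∈ range g, (n * p) ^ (l + 1)) / n +
      (M : ℝ) ^ n * 2 ^ (M * M) * (4 ^ n * Real.exp (-(p * n ^ 2 / (8 * r)))) < 1) :
    ∃ G : SimpleGraph (Fin n), (∀ (v : Fin n) (w : G.Walk v v), w.IsCycle → g < w.length) ∧
      ∀ (f : Fin n → Fin M) (Γ : SimpleGraph (Fin M)), (Γ.comap f).CliqueFree (r + 1) →
        n < Set.ncard {e : Sym2 (Fin n) | e ∈ G.edgeSet ∧ Sym2.map f e ∉ Γ.edgeSet} := by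
  classical
  have hnpos : 0 < n := by omega
  set 𝒞 : ℕ → Finset (Finset (Sym2 (Fin n))) := fun l =>
    {T ∈ univ.image (closedSeqEdges : (Fin (l + 1) → Fin n) → _) | #T = l + 1} with h𝒞
  set 𝒯 := (range g).biUnion 𝒞 with h𝒯
  set ℬ : Finset (Finset (Sym2 (Fin n))) :=
    image (fun q : (Fin n → Fin M) × SimpleGraph (Fin M) => ((q.2.comap q.1)ᶜ).edgeFinset)
      {q | (q.2.comap q.1).CliqueFree (r + 1)} with hℬ
  have h𝒞sum : ∀ l, ∑ T ∈ 𝒞 l, p ^ #T ≤ (n * p) ^ (l + 1) := fun l => by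
    have hcard : #(𝒞 l) ≤ n ^ (l + 1) :=
      (card_filter_le _ _).trans (card_image_le.trans (by simp))
    calc ∑ T ∈ 𝒞 l, p ^ #T = ∑ T ∈ 𝒞 l, p ^ (l + 1) :=
          sum_congr rfl fun T hT => by rw [(mem_filter.1 hT).2]
      _ = #(𝒞 l) * p ^ (l + 1) := by rw [sum_const, nsmul_eq_mul]
      _ ≤ (n : ℝ) ^ (l + 1) * p ^ (l + 1) := by
          gcongr
          exact_mod_cast hcard
      _ = (n * p) ^ (l + 1) := (mul_pow _ _ _).symm
  have h𝒞disj : ((range g : Finset ℕ) : Set ℕ).PairwiseDisjoint 𝒞 := fun i _ j _ hij =>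
    disjoint_left.2 fun T hi hj => hij <| by
      have := (mem_filter.1 hi).2.symm.trans (mem_filter.1 hj).2
      omega
  have h𝒯sum : ∑ T ∈ 𝒯, p ^ #T ≤ ∑ l ∈ range g, (n * p) ^ (l + 1) :=
    (sum_biUnion h𝒞disj).trans_le (sum_le_sum fun l _ => h𝒞sum l)
  have hℬcard : (#ℬ : ℝ) ≤ (M : ℝ) ^ n * 2 ^ (M * M) := by
    have hg : Fintype.card (SimpleGraph (Fin M)) ≤ 2 ^ (M * M) := by
      have := Fintype.card_le_of_injective
        (fun Γ : SimpleGraph (Fin M) => {q : Fin M × Fin M | Γ.Adj q.1 q.2}) (by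
          intro Γ Γ' hΓ
          ext a b
          exact Set.ext_iff.1 hΓ (a, b))
      simpa using this
    have : #ℬ ≤ M ^ n * 2 ^ (M * M) := by
      refine card_image_le.trans ((card_filter_le _ _).trans ?_)
      rw [card_univ, Fintype.card_prod]
      simpa using Nat.mul_le_mul_left (M ^ n) hg
    exact_mod_cast this
  have hℬterm : ∀ B ∈ ℬ, (4 : ℝ) ^ n * (1 - p / 2) ^ #B ≤
      4 ^ n * Real.exp (-(p * n ^ 2 / (8 * r))) := by
    intro B hB
    obtain ⟨q, hq, rfl⟩ := mem_image.1 hB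
    have hc : (n : ℝ) ^ 2 ≤ 4 * r * #((q.2.comap q.1)ᶜ).edgeFinset := by
      exact_mod_cast card_compl_edgeFinset_of_cliqueFree hr hn _ (mem_filter.1 hq).2
    have hr' : (0 : ℝ) < r := by exact_mod_cast hr
    gcongr
    calc (1 - p / 2) ^ #((q.2.comap q.1)ᶜ).edgeFinset
        ≤ Real.exp (-(p / 2)) ^ #((q.2.comap q.1)ᶜ).edgeFinset := by
          refine pow_le_pow_left₀ (by linarith) ?_ _
          exact Real.one_sub_le_exp_neg _
      _ = Real.exp (-(#((q.2.comap q.1)ᶜ).edgeFinset * (p / 2))) := by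
          rw [← Real.exp_nat_mul, mul_neg]
      _ ≤ Real.exp (-(p * n ^ 2 / (8 * r))) := by
          refine Real.exp_le_exp.2 (neg_le_neg ?_)
          rw [div_le_iff₀ (by positivity)]
          nlinarith [mul_le_mul_of_nonneg_left hc h0]
  obtain ⟨S, hS𝒯, hSℬ⟩ := exists_few_subsets_large_inter h0 h1 hnpos 𝒯 ℬ (by
    refine lt_of_le_of_lt (add_le_add ?_ ?_) h
    · gcongr
    · refine (sum_le_card_nsmul _ _ _ hℬterm).trans ?_
      rw [nsmul_eq_mul]
      gcongr)
  have hne : ∀ T ∈ 𝒯, T.Nonempty := fun T hT => by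
    obtain ⟨l, -, hl⟩ := mem_biUnion.1 hT
    exact card_pos.1 (by rw [(mem_filter.1 hl).2]; omega)
  obtain ⟨D, hDcard, hD⟩ := exists_card_le_forall_not_subset_sdiff 𝒯 hne S
  refine ⟨SimpleGraph.fromEdgeSet (S \ D : Finset (Sym2 (Fin n))), ?_, ?_⟩
  · intro v w hw
    by_contra! hlen
    obtain ⟨l, hl⟩ : ∃ l, w.length = l + 1 :=
      Nat.exists_eq_add_one.2 (by have := hw.three_le_length; omega)
    obtain ⟨c, hc, hcG⟩ := exists_closedSeqEdges_of_isCycle hw hl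
    refine hD (closedSeqEdges c) (mem_biUnion.2 ⟨l, mem_range.2 (by omega), ?_⟩) ?_
    · exact mem_filter.2 ⟨mem_image_of_mem _ (mem_univ c), hc⟩
    · intro e he
      have := hcG e he
      rw [SimpleGraph.edgeSet_fromEdgeSet] at this
      exact_mod_cast this.1
  · intro f Γ hΓ
    have hB := hSℬ _ (mem_image_of_mem _ (mem_filter.2 ⟨mem_univ (f, Γ), hΓ⟩))
    set B := ((Γ.comap f)ᶜ).edgeFinset with hBdef
    have hsub : (((S ∩ B) \ D : Finset (Sym2 (Fin n))) : Set (Sym2 (Fin n))) ⊆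
        {e | e ∈ (SimpleGraph.fromEdgeSet ((S \ D : Finset (Sym2 (Fin n))) :
          Set (Sym2 (Fin n)))).edgeSet ∧ Sym2.map f e ∉ Γ.edgeSet} := by
      intro e he
      induction e with | _ a b
      simp [hBdef] at he ⊢
      tauto
    have h2 := Set.ncard_le_ncard hsub (Set.toFinite _)
    rw [Set.ncard_coe_finset] at h2
    have h3 := le_card_sdiff D (S ∩ B)
    omega

open Filter in
theorem eventually_log_add_le_mul_rpow {s b : ℝ} (hs : 0 < s) (hb : 0 < b) (t : ℝ) :
    ∀ᶠ n : ℕ in atTop, Real.log n + t ≤ b * (n : ℝ) ^ s := by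
  have h1 := (isLittleO_log_rpow_atTop hs).bound (half_pos hb)
  have h2 := (tendsto_rpow_atTop hs).eventually_ge_atTop (t / (b / 2))
  have := h1.and (h2.and (eventually_ge_atTop 1))
  filter_upwards [tendsto_natCast_atTop_atTop.eventually this] with n hn
  obtain ⟨h1, h2, h3⟩ := hn
  rw [Real.norm_of_nonneg (Real.log_nonneg h3), Real.norm_of_nonneg (by positivity)] at h1
  rw [div_le_iff₀ (by positivity)] at h2
  linarith

theorem sum_range_div_pow_le {d : ℝ} (hd : 1 ≤ d) {g : ℕ} (hg : 0 < g) :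
    ∑ l ∈ range g, (d / (4 * g)) ^ (l + 1) ≤ d ^ g / 4 := by
  have hg' : (1 : ℝ) ≤ g := by exact_mod_cast hg
  have hterm : ∀ l ∈ range g, (d / (4 * g)) ^ (l + 1) ≤ d ^ g / (4 * g) := fun l hl => by
    rw [div_pow]
    have hl' : l + 1 ≤ g := mem_range.1 hl
    have hbase : (1 : ℝ) ≤ 4 * g := by linarith
    gcongr
    exact le_self_pow₀ hbase (by omega)
  refine (sum_le_card_nsmul _ _ _ hterm).trans_eq ?_
  rw [card_range, nsmul_eq_mul]
  field_simp

theorem pow_mul_two_pow_mul_exp_lt_half {n M : ℕ} {a : ℝ} (hn : 0 < n) (hMn : M ≤ n)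
    (hM : (M : ℝ) * M ≤ a * n) (ha : Real.log n + 3 ≤ 3 * a) :
    (M : ℝ) ^ n * 2 ^ (M * M) * (4 ^ n * Real.exp (-(4 * a * n))) < 1 / 2 := by
  have hn' : (1 : ℝ) ≤ n := by exact_mod_cast hn
  have h1 : (M : ℝ) ^ n ≤ Real.exp (n * Real.log n) := by
    rw [Real.exp_nat_mul, Real.exp_log (by linarith)]
    gcongr
  have htwo : (2 : ℝ) ≤ Real.exp 1 := by
    have := Real.add_one_le_exp (1 : ℝ)
    linarith
  have h2 : (2 : ℝ) ^ (M * M) ≤ Real.exp (a * n) := by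
    calc (2 : ℝ) ^ (M * M) ≤ Real.exp 1 ^ (M * M) := by gcongr
      _ = Real.exp (M * M) := by rw [← Real.exp_nat_mul]; push_cast; rw [mul_one]
      _ ≤ _ := Real.exp_le_exp.2 hM
  have h3 : (4 : ℝ) ^ n ≤ Real.exp (n * 2) := by
    rw [Real.exp_nat_mul]
    gcongr
    rw [show (2 : ℝ) = 1 + 1 by norm_num, Real.exp_add]
    nlinarith
  calc (M : ℝ) ^ n * 2 ^ (M * M) * (4 ^ n * Real.exp (-(4 * a * n)))
      ≤ Real.exp (n * Real.log n) * Real.exp (a * n) *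
        (Real.exp (n * 2) * Real.exp (-(4 * a * n))) := by gcongr
    _ = Real.exp (n * (Real.log n + 2 - 3 * a)) := by
        rw [← Real.exp_add, ← Real.exp_add, ← Real.exp_add]
        ring_nf
    _ ≤ Real.exp (-1) := Real.exp_le_exp.2 (by nlinarith)
    _ < 1 / 2 := by
        have := Real.exp_neg_one_lt_d9
        linarith

open Filter in
theorem eventually_exists_girth_gt_far_from_cliqueFree {g r : ℕ} (hg : 0 < g) (hr : 0 < r) :
    ∀ᶠ n : ℕ in atTop, ∀ M : ℕ,
      (M : ℝ) * M ≤ (n : ℝ) ^ ((1 : ℝ) / g) / (128 * g * r) * n →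
      ∃ G : SimpleGraph (Fin n), (∀ (v : Fin n) (w : G.Walk v v), w.IsCycle → g < w.length) ∧
        ∀ (f : Fin n → Fin M) (Γ : SimpleGraph (Fin M)), (Γ.comap f).CliqueFree (r + 1) →
          n < Set.ncard {e : Sym2 (Fin n) | e ∈ G.edgeSet ∧ Sym2.map f e ∉ Γ.edgeSet} := by
  have hg' : (1 : ℝ) ≤ g := by exact_mod_cast hg
  have hr' : (1 : ℝ) ≤ r := by exact_mod_cast hr
  have hs : (0 : ℝ) < 1 / g := by positivity
  filter_upwards [eventually_log_add_le_mul_rpow hs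
    (show (0 : ℝ) < 3 / (128 * g * r) by positivity) 3, eventually_ge_atTop (2 * r)]
    with n hlog hn M hM
  have hnpos : 0 < n := by omega
  have hn' : (1 : ℝ) ≤ n := by exact_mod_cast hnpos
  set d := (n : ℝ) ^ ((1 : ℝ) / g) with hd
  have hd1 : 1 ≤ d := Real.one_le_rpow hn' hs.le
  have hdn : d ≤ n := by
    simpa [hd] using Real.rpow_le_rpow_of_exponent_le hn' ((div_le_one (by linarith)).2 hg')
  have hdg : d ^ g = n := by
    rw [hd, one_div, Real.rpow_inv_natCast_pow (by linarith) (by omega)]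
  have hMn : M ≤ n := by
    have : d / (128 * g * r) ≤ n := (div_le_self (by linarith) (by nlinarith)).trans hdn
    have h2 : (M : ℝ) * M ≤ n * n := hM.trans (by gcongr)
    have h3 : M * M ≤ n * n := by exact_mod_cast h2
    exact Nat.mul_self_le_mul_self_iff.1 h3
  refine exists_girth_gt_far_from_cliqueFree (p := d / (4 * g * n)) (by positivity) ?_ hr hn ?_
  · rw [div_le_one (by positivity)]
    nlinarith
  · have hnp : (n : ℝ) * (d / (4 * g * n)) = d / (4 * g) := by field_simp
    have hexp : d / (4 * g * n) * n ^ 2 / (8 * r) = 4 * (d / (128 * g * r)) * n := by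
      field_simp
      norm_num
    have h1 := sum_range_div_pow_le hd1 hg
    have h2 := pow_mul_two_pow_mul_exp_lt_half hnpos hMn hM
      (hlog.trans_eq (by ring))
    rw [hnp, hexp]
    have h3 : (∑ l ∈ range g, (d / (4 * g)) ^ (l + 1)) / n ≤ 1 / 4 := by
      rw [div_le_iff₀ (by positivity)]
      linarith
    linarith

theorem cliqueFree_of_homFree {VF W : Type*} [Fintype VF] {F : SimpleGraph VF}
    {Γ : SimpleGraph W} (h : HomFree F Γ) : Γ.CliqueFree (Fintype.card VF) := by
  by_contra hc
  let e := SimpleGraph.topEmbeddingOfNotCliqueFree hc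
  let φ : F →g SimpleGraph.completeGraph (Fin (Fintype.card VF)) :=
    ⟨Fintype.equivFin VF, fun hab => by simpa using hab.ne⟩
  exact h.false (e.toHom.comp φ)

theorem homFree_of_girth_gt {VH V : Type*} {H : SimpleGraph VH} {G : SimpleGraph V} {v : VH}
    (c : H.Walk v v) (hc : Odd c.length)
    (hG : ∀ (v : V) (w : G.Walk v v), w.IsCycle → c.length < w.length) : HomFree H G := by
  refine ⟨fun φ => ?_⟩
  obtain ⟨u, w, hw, hlen⟩ := exists_isCycle_length_le_of_odd_closed_walk (c.map φ) (by simpa)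
  rw [SimpleGraph.Walk.length_map] at hlen
  exact absurd (hG u w hw) (by omega)

theorem stmt_15 {VF VH : Type} [Fintype VF] [Fintype VH]
    (F : SimpleGraph VF) (H : SimpleGraph VH)
    (hHF : Nonempty (H →g F)) (g : ℕ) (hgodd : Odd g)
    (hcyc : ∃ (v : VH) (c : H.Walk v v), c.IsCycle ∧ c.length = g)
    (hmin : ∀ (v : VH) (c : H.Walk v v), c.IsCycle → Odd c.length → g ≤ c.length) :
    ∃ c : ℝ, 0 < c ∧ ∃ ε₀ : ℝ, 0 < ε₀ ∧ ∀ ε : ℝ, 0 < ε → ε ≤ ε₀ →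
      ∃ (N : ℕ) (G : SimpleGraph (Fin N)), HomFree H G ∧
        ∀ (W : Type) [Fintype W],
          (Fintype.card W : ℝ) ≤ c * (1 / ε) ^ ((1 : ℝ) / 2 + 1 / (2 * (g : ℝ))) →
          ∀ Γ : SimpleGraph W, HomFree F Γ →
            ∀ f : Fin N → W, ¬ IsApproxHom ε G Γ f := by
  obtain ⟨v₀, c₀, -, hc₀⟩ := hcyc
  have hg : 0 < g := hgodd.pos
  have hg' : (1 : ℝ) ≤ g := by exact_mod_cast hg
  set r := Fintype.card VF + 1 with hr
  have hr' : (1 : ℝ) ≤ r := by exact_mod_cast Nat.succ_pos _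
  obtain ⟨n₀, hn₀⟩ := Filter.eventually_atTop.1
    (eventually_exists_girth_gt_far_from_cliqueFree hg (show 0 < r from Nat.succ_pos _))
  set C := √(1 / (512 * g * r)) with hC
  have hCsq : C * C = 1 / (512 * g * r) := Real.mul_self_sqrt (by positivity)
  refine ⟨C, by positivity, 1 / (n₀ + 1), by positivity, fun ε hε hε₀ => ?_⟩
  have hinv : (n₀ : ℝ) + 1 ≤ 1 / ε := by
    rw [le_div_iff₀ hε]
    rwa [le_div_iff₀ (by positivity), mul_comm] at hε₀
  set n := ⌊1 / ε⌋₊ with hn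
  have hnε : (n : ℝ) ≤ 1 / ε := Nat.floor_le (by positivity)
  have hn₀n : n₀ + 1 ≤ n := Nat.le_floor (by exact_mod_cast hinv)
  have hn1 : (1 : ℝ) ≤ n := by exact_mod_cast (show 1 ≤ n by omega)
  have hεn : 1 / ε ≤ 2 * n := by
    have := Nat.lt_floor_add_one (1 / ε)
    linarith
  set α : ℝ := 1 / 2 + 1 / (2 * (g : ℝ)) with hα
  have hα0 : 0 ≤ α := by positivity
  have hα1 : α ≤ 1 := by
    have : 1 / (2 * (g : ℝ)) ≤ 1 / 2 := one_div_le_one_div_of_le (by norm_num) (by linarith)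
    linarith
  have hpow : (1 / ε) ^ α ≤ 2 * (n : ℝ) ^ α := by
    calc (1 / ε) ^ α ≤ (2 * n) ^ α := Real.rpow_le_rpow (by positivity) hεn hα0
      _ = 2 ^ α * (n : ℝ) ^ α := Real.mul_rpow (by norm_num) (by positivity)
      _ ≤ 2 * (n : ℝ) ^ α := by
          gcongr
          simpa using Real.rpow_le_rpow_of_exponent_le (by norm_num : (1 : ℝ) ≤ 2) hα1
  have hnα : (n : ℝ) ^ α * (n : ℝ) ^ α = (n : ℝ) ^ ((1 : ℝ) / g) * n := by
    rw [← Real.rpow_add (by linarith), ← Real.rpow_add_one (by linarith)]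
    congr 1
    rw [hα]
    field_simp
    ring
  set M := ⌊C * (1 / ε) ^ α⌋₊ with hM
  have hM_le : (M : ℝ) ≤ C * (2 * (n : ℝ) ^ α) :=
    (Nat.floor_le (by positivity)).trans (by gcongr)
  obtain ⟨G, hgirth, hfar⟩ := hn₀ n (by omega) M (by
    calc (M : ℝ) * M ≤ (C * (2 * (n : ℝ) ^ α)) * (C * (2 * (n : ℝ) ^ α)) := by gcongr
      _ = 4 * (C * C) * ((n : ℝ) ^ α * (n : ℝ) ^ α) := by ring
      _ = _ := by
          rw [hCsq, hnα]
          field_simp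
          norm_num)
  refine ⟨n, G, homFree_of_girth_gt c₀ (hc₀ ▸ hgodd) (hc₀ ▸ hgirth), ?_⟩
  intro W _ hW Γ hΓ f happrox
  obtain ⟨ι⟩ : Nonempty (W ↪ Fin M) :=
    Function.Embedding.nonempty_of_card_le (by
      rw [Fintype.card_fin]
      exact Nat.le_floor hW)
  have hcomap : (Γ.map ι).comap (ι ∘ f) = Γ.comap f := by
    rw [← SimpleGraph.comap_comap, SimpleGraph.comap_map_eq]
  have hfree : HomFree F (Γ.comap f) := ⟨fun φ => hΓ.false ((SimpleGraph.Hom.comap f Γ).comp φ)⟩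
  have hlt := hfar (ι ∘ f) (Γ.map ι) (by
    rw [hcomap]
    exact (cliqueFree_of_homFree hfree).mono (by omega))
  have hset : {e : Sym2 (Fin n) | e ∈ G.edgeSet ∧ Sym2.map (ι ∘ f) e ∉ (Γ.map ι).edgeSet} =
      {e | e ∈ G.edgeSet ∧ Sym2.map f e ∉ Γ.edgeSet} := by
    ext e
    induction e with | _ a b
    have : (Γ.map ι).Adj (ι (f a)) (ι (f b)) ↔ Γ.Adj (f a) (f b) := by simp
    simp only [Set.mem_ofPred_eq, Sym2.map_mk, SimpleGraph.mem_edgeSet, Function.comp, this]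
  rw [hset] at hlt
  have hle : (Set.ncard {e : Sym2 (Fin n) | e ∈ G.edgeSet ∧ Sym2.map f e ∉ Γ.edgeSet} : ℝ) ≤
      ε * (n : ℝ) ^ 2 := by
    simpa [IsApproxHom] using happrox
  have hεn2 : ε * (n : ℝ) ^ 2 ≤ n := by
    rw [le_div_iff₀ hε] at hnε
    nlinarith
  have hlt' : (n : ℝ) <
      Set.ncard {e : Sym2 (Fin n) | e ∈ G.edgeSet ∧ Sym2.map f e ∉ Γ.edgeSet} := by
    exact_mod_cast hlt
  linarith
end
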